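/- Let γ ∈ (−3, 1]. There exists a constant C > 0, depending only on γ, such that for every measurable function f : ℝ³ → ℝ and every continuously differentiable function g : ℝ³ → ℝ, ∫_{ℝ³} ∫_{ℝ³} |v − v_*|^{γ} |f(v_*)| |g(v)|² dv_* dv ≤ C · ‖f‖_{L²_5} · ‖g‖_{H¹_{γ/2}}². -/

import Mathlib

open MeasureTheory ENNReal

noncomputable section

/-- Japanese bracket `⟨v⟩ = (1 + |v|²)^(1/2)`. -/
def jb (v : EuclideanSpace ℝ (Fin 3)) : ℝ := (1 + ‖v‖ ^ 2) ^ ((1 : ℝ) / 2)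

/-- Weighted `L²` norm `‖⟨v⟩^l f‖_{L²(ℝ³)}` (with values in `[0,∞]`). -/
def eL2w (l : ℝ) (f : EuclideanSpace ℝ (Fin 3) → ℝ) : ℝ≥0∞ :=
  (∫⁻ v, (ENNReal.ofReal (jb v ^ l * |f v|)) ^ (2 : ℕ)) ^ ((1 : ℝ) / 2)

/-- Weighted `L²` norm of the gradient, `‖⟨v⟩^l ∇f‖_{L²(ℝ³)}`. -/
def eL2gradw (l : ℝ) (f : EuclideanSpace ℝ (Fin 3) → ℝ) : ℝ≥0∞ :=
  (∫⁻ v, (ENNReal.ofReal (jb v ^ l * ‖gradient f v‖)) ^ (2 : ℕ)) ^ ((1 : ℝ) / 2)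

/-- Weighted first-order Sobolev norm `‖f‖_{H¹_l} = ‖⟨v⟩^l f‖_{L²} + ‖⟨v⟩^l ∇f‖_{L²}`. -/
def eH1w (l : ℝ) (f : EuclideanSpace ℝ (Fin 3) → ℝ) : ℝ≥0∞ :=
  eL2w l f + eL2gradw l f

lemma jb_pos (v : EuclideanSpace ℝ (Fin 3)) : 0 < jb v := by
  unfold jb; positivity

lemma jb_sq (v : EuclideanSpace ℝ (Fin 3)) : jb v ^ 2 = 1 + ‖v‖ ^ 2 := by
  unfold jb
  rw [← Real.sqrt_eq_rpow, Real.sq_sqrt (by positivity)]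

lemma one_le_jb (v : EuclideanSpace ℝ (Fin 3)) : 1 ≤ jb v := by
  nlinarith [jb_sq v, jb_pos v, sq_nonneg ‖v‖]

lemma norm_le_jb (v : EuclideanSpace ℝ (Fin 3)) : ‖v‖ ≤ jb v :=
  le_of_sq_le_sq (by rw [jb_sq]; linarith) (jb_pos v).le

lemma jb_add_le (v w : EuclideanSpace ℝ (Fin 3)) : jb (v + w) ≤ 2 * jb v * jb w := by
  have hv := jb_pos v
  have hw := jb_pos w
  refine le_of_sq_le_sq ?_ (by positivity)
  have h : ‖v + w‖ ^ 2 ≤ (‖v‖ + ‖w‖) ^ 2 := by gcongr; exact norm_add_le v w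
  rw [mul_pow, mul_pow, jb_sq, jb_sq, jb_sq]
  nlinarith [sq_nonneg (‖v‖ - ‖w‖), mul_nonneg (sq_nonneg ‖v‖) (sq_nonneg ‖w‖)]

lemma contDiff_jb_rpow (l : ℝ) : ContDiff ℝ 1 (fun v => jb v ^ l) := by
  have h : ContDiff ℝ 1 jb := by
    unfold jb
    exact (contDiff_const.add (contDiff_norm_sq ℝ)).rpow_const_of_ne
      (fun v => by positivity)
  exact h.rpow_const_of_ne fun v => (jb_pos v).ne'

lemma measurable_jb : Measurable jb := by
  unfold jb; fun_prop

lemma norm_fderiv_jb_rpow_le (l : ℝ) (v : EuclideanSpace ℝ (Fin 3)) :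
    ‖fderiv ℝ (fun v => jb v ^ l) v‖ ≤ |l| * jb v ^ l := by
  have hv := jb_pos v
  have h : (fun v => jb v ^ l) =
      fun v : EuclideanSpace ℝ (Fin 3) => (1 + ‖v‖ ^ 2) ^ (l / 2) := by
    funext w
    unfold jb
    rw [← Real.rpow_mul (by positivity)]
    ring_nf
  have hd : HasFDerivAt (fun v : EuclideanSpace ℝ (Fin 3) => (1 + ‖v‖ ^ 2) ^ (l / 2))
      ((l / 2 * (1 + ‖v‖ ^ 2) ^ (l / 2 - 1)) • (2 • innerSL ℝ v)) v :=
    ((hasStrictFDerivAt_norm_sq v).hasFDerivAt.const_add 1).rpow_const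
      (Or.inl (by positivity))
  have hl : jb v ^ l = (1 + ‖v‖ ^ 2) ^ (l / 2) := congrFun h v
  rw [hl, h, hd.fderiv, norm_smul, ← Nat.cast_smul_eq_nsmul ℝ, norm_smul, innerSL_apply_norm,
    Real.rpow_sub_one (by positivity), Real.norm_eq_abs, abs_mul, abs_div, abs_div,
    abs_of_pos (show (0 : ℝ) < (1 + ‖v‖ ^ 2) ^ (l / 2) by positivity),
    abs_of_pos (show (0 : ℝ) < 1 + ‖v‖ ^ 2 by positivity)]
  have hfrac : ‖v‖ / (1 + ‖v‖ ^ 2) ≤ 1 := by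
    rw [div_le_one (by positivity)]
    nlinarith [sq_nonneg (‖v‖ - 1), norm_nonneg v]
  calc _ = |l| * (1 + ‖v‖ ^ 2) ^ (l / 2) * (‖v‖ / (1 + ‖v‖ ^ 2)) := by
        norm_num; ring
    _ ≤ _ := mul_le_of_le_one_right (by positivity) hfrac

lemma jb_rpow_le {γ : ℝ} (hγ : γ ∈ Set.Ioc (-3 : ℝ) 1) {x y z : EuclideanSpace ℝ (Fin 3)}
    (hz : jb z ≤ 2 * jb x * jb y) (hx : jb x ≤ 2 * jb z * jb y) :
    jb z ^ γ ≤ 8 * (jb x ^ γ * jb y ^ (3 : ℝ)) := by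
  have px := jb_pos x
  have py := jb_pos y
  have pz := jb_pos z
  rcases le_or_gt 0 γ with h | h
  · calc jb z ^ γ ≤ (2 * jb x * jb y) ^ γ := by gcongr
      _ = 2 ^ γ * (jb x ^ γ * jb y ^ γ) := by
        rw [Real.mul_rpow (by positivity) py.le, Real.mul_rpow (by positivity) px.le]; ring
      _ ≤ 2 ^ (3 : ℝ) * (jb x ^ γ * jb y ^ (3 : ℝ)) := by
        gcongr
        · norm_num
        · linarith [hγ.2]
        · exact one_le_jb y
        · linarith [hγ.2]
      _ = _ := by norm_num
  · calc jb z ^ γ ≤ (jb x / (2 * jb y)) ^ γ := by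
          apply Real.rpow_le_rpow_of_nonpos (by positivity) _ h.le
          rw [div_le_iff₀ (by positivity)]
          linarith
      _ = 2 ^ (-γ) * (jb x ^ γ * jb y ^ (-γ)) := by
        rw [Real.div_rpow px.le (by positivity), Real.mul_rpow (by positivity) py.le,
          Real.rpow_neg (by positivity), Real.rpow_neg py.le]
        field_simp
      _ ≤ 2 ^ (3 : ℝ) * (jb x ^ γ * jb y ^ (3 : ℝ)) := by
        gcongr
        · norm_num
        · linarith [hγ.1]
        · exact one_le_jb y
        · linarith [hγ.1]
      _ = _ := by norm_num

lemma norm_rpow_le_jb_rpow {γ : ℝ} (hγ : γ ∈ Set.Ioc (-3 : ℝ) 1)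
    (z : EuclideanSpace ℝ (Fin 3)) :
    ‖z‖ ^ γ ≤ 8 * jb z ^ γ * (1 + (Metric.closedBall 0 1).indicator (fun z => ‖z‖ ^ γ) z) := by
  have pz := jb_pos z
  have oz := one_le_jb z
  have hsq := jb_sq z
  have h8 : (8 : ℝ) = 2 ^ (3 : ℝ) := by norm_num
  by_cases hz : z ∈ Metric.closedBall (0 : EuclideanSpace ℝ (Fin 3)) 1
  · rw [Set.indicator_of_mem hz]
    rw [mem_closedBall_zero_iff] at hz
    have hk : 0 ≤ ‖z‖ ^ γ := by positivity
    have h2 : jb z ≤ 2 := by nlinarith [norm_nonneg z]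
    have h1 : 1 ≤ 8 * jb z ^ γ := by
      calc (1 : ℝ) = 8 * (2 : ℝ) ^ (-3 : ℝ) := by rw [Real.rpow_neg (by norm_num)]; norm_num
        _ ≤ 8 * jb z ^ (-3 : ℝ) := by
          have : (2 : ℝ) ^ (-3 : ℝ) ≤ jb z ^ (-3 : ℝ) :=
            Real.rpow_le_rpow_of_nonpos pz h2 (by norm_num)
          linarith
        _ ≤ 8 * jb z ^ γ := by
          have : jb z ^ (-3 : ℝ) ≤ jb z ^ γ := Real.rpow_le_rpow_of_exponent_le oz hγ.1.le
          linarith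
    nlinarith
  · rw [Set.indicator_of_notMem hz, add_zero, mul_one]
    rw [mem_closedBall_zero_iff, not_le] at hz
    have hzp : 0 < ‖z‖ := by linarith
    rcases le_or_gt 0 γ with h | h
    · have : ‖z‖ ^ γ ≤ jb z ^ γ := Real.rpow_le_rpow hzp.le (norm_le_jb z) h
      have : 0 ≤ jb z ^ γ := by positivity
      linarith
    · calc ‖z‖ ^ γ ≤ (jb z / 2) ^ γ := by
            apply Real.rpow_le_rpow_of_nonpos (by positivity) _ h.le
            nlinarith
        _ = 2 ^ (-γ) * jb z ^ γ := by
          rw [Real.div_rpow pz.le (by norm_num), Real.rpow_neg (by norm_num)]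
          field_simp
        _ ≤ 8 * jb z ^ γ := by
          rw [h8]
          gcongr
          · norm_num
          · linarith [hγ.1]

lemma norm_sub_rpow_le {γ : ℝ} (hγ : γ ∈ Set.Ioc (-3 : ℝ) 1)
    (v w : EuclideanSpace ℝ (Fin 3)) :
    ‖v - w‖ ^ γ ≤ 64 * (jb v ^ γ * jb w ^ (3 : ℝ)) *
      (1 + (Metric.closedBall 0 1).indicator (fun z => ‖z‖ ^ γ) (v - w)) := by
  have hneg : jb (-w) = jb w := by simp [jb]
  have h1 : jb (v - w) ≤ 2 * jb v * jb w := by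
    simpa [sub_eq_add_neg, hneg] using jb_add_le v (-w)
  have h2 : jb v ≤ 2 * jb (v - w) * jb w := by simpa using jb_add_le (v - w) w
  have h3 := jb_rpow_le hγ h1 h2
  have hk : 0 ≤ (Metric.closedBall (0 : EuclideanSpace ℝ (Fin 3)) 1).indicator
      (fun z => ‖z‖ ^ γ) (v - w) := Set.indicator_nonneg (fun _ _ => by positivity) _
  refine (norm_rpow_le_jb_rpow hγ (v - w)).trans ?_
  refine mul_le_mul_of_nonneg_right ?_ (by linarith)
  linarith

lemma lintegral_norm_rpow_closedBall_lt_top {γ : ℝ} (hγ : -3 < γ) :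
    ∫⁻ z : EuclideanSpace ℝ (Fin 3),
      ENNReal.ofReal ((Metric.closedBall 0 1).indicator (fun z => ‖z‖ ^ γ) z) < ∞ := by
  have hloc : LocallyIntegrable (fun z : EuclideanSpace ℝ (Fin 3) => ‖z‖ ^ γ) volume := by
    refine locallyIntegrable_of_norm_le_rpow (C := 1) (α := -γ) (by simp)
      (by simp; linarith) ?_ (Measurable.aestronglyMeasurable (by fun_prop))
    filter_upwards with z
    rw [Real.norm_of_nonneg (by positivity)]
    simp
  exact ((integrable_indicator_iff measurableSet_closedBall).2
    (hloc.integrableOn_isCompact (isCompact_closedBall 0 1))).lintegral_lt_top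

lemma lintegral_jb_lt_top :
    ∫⁻ v, ENNReal.ofReal (jb v ^ (-2 : ℝ)) ^ 2 < ∞ := by
  have h : Integrable
      (fun v : EuclideanSpace ℝ (Fin 3) => ((1 : ℝ) + ‖v‖ ^ 2) ^ (-(4 : ℝ) / 2)) :=
    integrable_rpow_neg_one_add_norm_sq (by simp; norm_num)
  convert h.lintegral_lt_top using 3 with v
  have hv := jb_pos v
  rw [← ENNReal.ofReal_pow (by positivity), ← jb_sq, ← Real.rpow_natCast (jb v) 2,
    ← Real.rpow_mul hv.le, ← Real.rpow_natCast (jb v ^ (-2 : ℝ)) 2, ← Real.rpow_mul hv.le]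
  norm_num

lemma lintegral_mul_le_sqrt {α : Type*} [MeasurableSpace α] {μ : Measure α} {a b : α → ℝ≥0∞}
    (ha : AEMeasurable a μ) (hb : AEMeasurable b μ) :
    ∫⁻ x, a x * b x ∂μ ≤
      (∫⁻ x, a x ^ 2 ∂μ) ^ ((1 : ℝ) / 2) * (∫⁻ x, b x ^ 2 ∂μ) ^ ((1 : ℝ) / 2) := by
  have h := ENNReal.lintegral_mul_le_Lp_mul_Lq μ
    (Real.HolderConjugate.two_two) ha hb
  simpa only [Pi.mul_apply, ENNReal.rpow_two] using h

lemma rpow_half_sq (x : ℝ≥0∞) : (x ^ ((1 : ℝ) / 2)) ^ 2 = x := by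
  rw [← ENNReal.rpow_natCast, ← ENNReal.rpow_mul]
  norm_num

lemma sq_rpow_half (x : ℝ≥0∞) : (x ^ 2) ^ ((1 : ℝ) / 2) = x := by
  rw [← ENNReal.rpow_natCast, ← ENNReal.rpow_mul]
  norm_num

lemma eLpNorm_jb_mul_norm (l : ℝ) {F : Type*} [NormedAddCommGroup F]
    (g : EuclideanSpace ℝ (Fin 3) → F) {n : ℕ} (hn : n ≠ 0) :
    eLpNorm (fun v => jb v ^ l * ‖g v‖) n volume =
      (∫⁻ v, ENNReal.ofReal (jb v ^ l * ‖g v‖) ^ n) ^ ((1 : ℝ) / n) := by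
  have h : ∀ v, ‖jb v ^ l * ‖g v‖‖ₑ = ENNReal.ofReal (jb v ^ l * ‖g v‖) := fun v =>
    Real.enorm_of_nonneg (by have := jb_pos v; positivity)
  rw [eLpNorm_eq_lintegral_rpow_enorm_toReal (by simpa using hn) (by simp)]
  simp only [ENNReal.toReal_natCast, h, ENNReal.rpow_natCast]

lemma exists_cutoff : ∃ M : ℝ, 0 ≤ M ∧ ∃ χ : ℕ → EuclideanSpace ℝ (Fin 3) → ℝ, ∀ n,
    ContDiff ℝ 1 (χ n) ∧ HasCompactSupport (χ n) ∧ (∀ v, |χ n v| ≤ 1) ∧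
    (∀ v, ‖v‖ ≤ n + 1 → χ n v = 1) ∧ ∀ v, ‖fderiv ℝ (χ n) v‖ ≤ M := by
  let b : ContDiffBump (0 : EuclideanSpace ℝ (Fin 3)) := ⟨1, 2, by norm_num, by norm_num⟩
  have hb : ContDiff ℝ 1 b := b.contDiff
  obtain ⟨M, hM⟩ := (hb.continuous_fderiv one_ne_zero).bounded_above_of_compact_support
    (b.hasCompactSupport.fderiv (𝕜 := ℝ))
  refine ⟨M, (norm_nonneg _).trans (hM 0), fun n v => b (((n : ℝ) + 1)⁻¹ • v), fun n => ?_⟩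
  have hn : (0 : ℝ) < (n : ℝ) + 1 := by positivity
  refine ⟨hb.comp (contDiff_const_smul _), ?_, fun v => ?_, fun v hv => ?_, fun v => ?_⟩
  · exact b.hasCompactSupport.comp_smul (inv_ne_zero hn.ne')
  · rw [abs_of_nonneg b.nonneg]
    exact b.le_one
  · apply b.one_of_mem_closedBall
    rw [mem_closedBall_zero_iff, norm_smul, norm_inv, Real.norm_of_nonneg hn.le,
      inv_mul_le_iff₀ hn]
    simpa [b] using hv
  · have h := fderiv_comp_smul (𝕜 := ℝ) (f := b) (((n : ℝ) + 1)⁻¹) (x := v)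
    rw [h, norm_smul, norm_inv, Real.norm_of_nonneg hn.le]
    have h1 : ((n : ℝ) + 1)⁻¹ ≤ 1 := inv_le_one_of_one_le₀ (by linarith [n.cast_nonneg (α := ℝ)])
    calc _ ≤ 1 * M := mul_le_mul h1 (hM _) (norm_nonneg _) zero_le_one
      _ = M := one_mul M

lemma exists_eLpNorm_six_le_eH1w (l : ℝ) : ∃ K : ℝ≥0∞, K ≠ ∞ ∧
    ∀ g : EuclideanSpace ℝ (Fin 3) → ℝ, ContDiff ℝ 1 g →
      eLpNorm (fun v => jb v ^ l * ‖g v‖) 6 volume ≤ K * eH1w l g := by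
  obtain ⟨M, hM0, χ, hχ⟩ := exists_cutoff
  let S : ℝ≥0∞ := SNormLESNormFDerivOfEqConst ℝ
    (volume : Measure (EuclideanSpace ℝ (Fin 3))) (2 : NNReal)
  refine ⟨S * ENNReal.ofReal (M + |l| + 1),
    ENNReal.mul_ne_top ENNReal.coe_ne_top ENNReal.ofReal_ne_top, fun g hg => ?_⟩
  have hw := contDiff_jb_rpow l
  have hmg : Measurable g := hg.continuous.measurable
  have hmj := measurable_jb
  have hmd : Measurable (fderiv ℝ g) := (hg.continuous_fderiv one_ne_zero).measurable
  let u : ℕ → EuclideanSpace ℝ (Fin 3) → ℝ := fun n v => χ n v * (jb v ^ l * g v)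
  have hcu : ∀ n, ContDiff ℝ 1 (u n) := fun n => (hχ n).1.mul (hw.mul hg)
  have hsu : ∀ n, HasCompactSupport (u n) := fun n => (hχ n).2.1.mul_right
  have hbound : ∀ n, eLpNorm (u n) 6 volume ≤
      S * ENNReal.ofReal (M + |l| + 1) * eH1w l g := by
    intro n
    have hgns := eLpNorm_le_eLpNorm_fderiv_of_eq
      (volume : Measure (EuclideanSpace ℝ (Fin 3))) (hcu n) (hsu n)
      (p := 2) (p' := 6) (by norm_num) (by simp) (by simp; norm_num)
    have hder : ∀ v, ‖fderiv ℝ (u n) v‖ ≤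
        (M + |l| + 1) * ‖jb v ^ l * ‖g v‖ + jb v ^ l * ‖fderiv ℝ g v‖‖ := by
      intro v
      obtain ⟨h1, -, h2, -, h3⟩ := hχ n
      have hv := jb_pos v
      have hwv : 0 < jb v ^ l := by positivity
      have e1 : fderiv ℝ (u n) v = χ n v • (jb v ^ l • fderiv ℝ g v
          + g v • fderiv ℝ (fun v => jb v ^ l) v) + (jb v ^ l * g v) • fderiv ℝ (χ n) v := by
        have d1 := (h1.differentiable one_ne_zero v).hasFDerivAt
        have d2 := (hw.differentiable one_ne_zero v).hasFDerivAt
        have d3 := (hg.differentiable one_ne_zero v).hasFDerivAt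
        exact (d1.mul (d2.mul d3)).fderiv
      have hsum : 0 ≤ jb v ^ l * ‖g v‖ + jb v ^ l * ‖fderiv ℝ g v‖ := by positivity
      rw [e1, Real.norm_of_nonneg hsum]
      calc _ ≤ |χ n v| * (jb v ^ l * ‖fderiv ℝ g v‖
              + ‖g v‖ * ‖fderiv ℝ (fun v => jb v ^ l) v‖)
              + jb v ^ l * ‖g v‖ * ‖fderiv ℝ (χ n) v‖ := by
            refine (norm_add_le _ _).trans ?_
            rw [norm_smul, norm_smul, norm_mul, Real.norm_of_nonneg hwv.le, Real.norm_eq_abs]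
            gcongr
            refine (norm_add_le _ _).trans ?_
            rw [norm_smul, norm_smul, Real.norm_of_nonneg hwv.le]
        _ ≤ 1 * (jb v ^ l * ‖fderiv ℝ g v‖ + ‖g v‖ * (|l| * jb v ^ l))
              + jb v ^ l * ‖g v‖ * M := by
            gcongr
            · exact h2 v
            · exact norm_fderiv_jb_rpow_le l v
            · exact h3 v
        _ ≤ _ := by
            have p1 : 0 ≤ jb v ^ l * ‖g v‖ := by positivity
            have p2 : 0 ≤ (M + |l|) * (jb v ^ l * ‖fderiv ℝ g v‖) := by positivity
            linarith
    have hL2 := eLpNorm_le_mul_eLpNorm_of_ae_le_mul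
      (μ := (volume : Measure (EuclideanSpace ℝ (Fin 3))))
      (Filter.Eventually.of_forall hder) 2
    have hadd : eLpNorm (fun v => jb v ^ l * ‖g v‖ + jb v ^ l * ‖fderiv ℝ g v‖) 2 volume ≤
        eH1w l g := by
      have e0 : ∀ v, ‖gradient g v‖ = ‖fderiv ℝ g v‖ := fun v => by simp [gradient]
      have e1 := eLpNorm_jb_mul_norm l g two_ne_zero
      have e2 := eLpNorm_jb_mul_norm l (fderiv ℝ g) two_ne_zero
      rw [Nat.cast_ofNat, Nat.cast_ofNat] at e1 e2
      have h := eLpNorm_add_le (μ := (volume : Measure (EuclideanSpace ℝ (Fin 3))))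
        (f := fun v => jb v ^ l * ‖g v‖) (g := fun v => jb v ^ l * ‖fderiv ℝ g v‖) (p := 2)
        (Measurable.aestronglyMeasurable (by fun_prop))
        (Measurable.aestronglyMeasurable (by fun_prop)) (by norm_num)
      unfold eH1w eL2w eL2gradw
      simp only [e0, ← Real.norm_eq_abs]
      exact h.trans (le_of_eq (congrArg₂ (· + ·) e1 e2))
    calc eLpNorm (u n) 6 volume ≤ S * eLpNorm (fderiv ℝ (u n)) 2 volume := hgns
      _ ≤ S * (ENNReal.ofReal (M + |l| + 1) * eH1w l g) := by
          gcongr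
          exact hL2.trans (by gcongr)
      _ = _ := by rw [mul_assoc]
  have hlim := Lp.eLpNorm_lim_le_liminf_eLpNorm
    (μ := (volume : Measure (EuclideanSpace ℝ (Fin 3)))) (p := 6)
    (fun n => (hcu n).continuous.aestronglyMeasurable) (fun v => jb v ^ l * g v)
    (Filter.Eventually.of_forall fun v => by
      apply tendsto_const_nhds.congr'
      filter_upwards [Filter.eventually_ge_atTop ⌈‖v‖⌉₊] with n hn
      have : ‖v‖ ≤ n + 1 := by
        have := (Nat.le_ceil ‖v‖).trans (Nat.cast_le.2 hn)
        linarith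
      simp [u, (hχ n).2.2.2.1 v this])
  have hnorm : eLpNorm (fun v => jb v ^ l * ‖g v‖) 6 volume =
      eLpNorm (fun v => jb v ^ l * g v) 6 volume :=
    eLpNorm_congr_norm_ae (Filter.Eventually.of_forall fun v => by simp)
  rw [hnorm]
  refine hlim.trans ?_
  exact Filter.liminf_le_of_le (by isBoundedDefault) fun b hb => by
    obtain ⟨n, hn⟩ := hb.exists
    exact hn.trans (hbound n)

lemma exists_lintegral_pow_four_le_eH1w (l : ℝ) : ∃ K : ℝ≥0∞, K ≠ ∞ ∧
    ∀ g : EuclideanSpace ℝ (Fin 3) → ℝ, ContDiff ℝ 1 g →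
      ∫⁻ v, ENNReal.ofReal (jb v ^ l * |g v|) ^ 4 ≤ (K * eH1w l g ^ 2) ^ 2 := by
  obtain ⟨K, hK, h⟩ := exists_eLpNorm_six_le_eH1w l
  refine ⟨(K ^ 3) ^ ((1 : ℝ) / 2),
    ENNReal.rpow_ne_top_of_nonneg (by norm_num) (ENNReal.pow_ne_top hK), fun g hg => ?_⟩
  have hmg : Measurable g := hg.continuous.measurable
  have hmj := measurable_jb
  have h6 := h g hg
  have e := eLpNorm_jb_mul_norm l g (n := 6) (by norm_num)
  rw [Nat.cast_ofNat, Nat.cast_ofNat] at e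
  rw [e] at h6
  simp only [Real.norm_eq_abs] at h6
  set a : EuclideanSpace ℝ (Fin 3) → ℝ≥0∞ := fun v => ENNReal.ofReal (jb v ^ l * |g v|) with ha
  have hma : Measurable a := by fun_prop
  have hcs := lintegral_mul_le_sqrt (μ := volume) hma.aemeasurable
    (hma.pow_const 3).aemeasurable
  have e6 : (∫⁻ v, (a v ^ 3) ^ 2) ^ ((1 : ℝ) / 2) =
      ((∫⁻ v, a v ^ 6) ^ ((1 : ℝ) / 6)) ^ 3 := by
    rw [← ENNReal.rpow_natCast (_ ^ _), ← ENNReal.rpow_mul]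
    simp only [← pow_mul]
    norm_num
  have hl2 : (∫⁻ v, a v ^ 2) ^ ((1 : ℝ) / 2) ≤ eH1w l g := le_self_add
  calc ∫⁻ v, a v ^ 4 = ∫⁻ v, a v * a v ^ 3 := by simp only [← pow_succ']
    _ ≤ eH1w l g * (K * eH1w l g) ^ 3 := by
        refine hcs.trans ?_
        rw [e6]
        gcongr
    _ = _ := by rw [mul_pow (_ ^ _), rpow_half_sq]; ring

lemma lintegral_convolution_mul_le {k F b : EuclideanSpace ℝ (Fin 3) → ℝ≥0∞}
    (hk : Measurable k) (hF : Measurable F) (hb : Measurable b) :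
    ∫⁻ v, ∫⁻ w, k (v - w) * (F w * b v) ≤
      (∫⁻ z, k z) * ((∫⁻ w, F w ^ 2) ^ ((1 : ℝ) / 2) * (∫⁻ v, b v ^ 2) ^ ((1 : ℝ) / 2)) := by
  have hchange : ∀ v, ∫⁻ w, k (v - w) * (F w * b v) = ∫⁻ z, k z * (F (v - z) * b v) := by
    intro v
    rw [← lintegral_sub_left_eq_self (fun z => k z * (F (v - z) * b v)) v]
    simp
  simp only [hchange]
  rw [lintegral_lintegral_swap (Measurable.aemeasurable (by fun_prop)),
    ← lintegral_mul_const _ hk]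
  refine lintegral_mono fun z => ?_
  rw [lintegral_const_mul _ (by fun_prop)]
  gcongr
  refine (lintegral_mul_le_sqrt (Measurable.aemeasurable (by fun_prop)) hb.aemeasurable).trans ?_
  rw [lintegral_sub_right_eq_self (fun w => F w ^ 2) z]

/-- For `γ ∈ (-3,1]` there is `C > 0` depending only on `γ` such that for
every measurable `f` and every `C¹` function `g`,
`∫∫ |v-v_*|^γ |f(v_*)| |g(v)|² dv_* dv ≤ C ‖f‖_{L²_5} ‖g‖_{H¹_{γ/2}}²`. -/
theorem convolution_weight_bound_gamma_square (γ : ℝ) (hγ : γ ∈ Set.Ioc (-3 : ℝ) 1) :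
    ∃ C : ℝ, 0 < C ∧
      ∀ f g : EuclideanSpace ℝ (Fin 3) → ℝ,
        Measurable f → ContDiff ℝ 1 g →
        (∫⁻ v, ∫⁻ vs, ENNReal.ofReal (‖v - vs‖ ^ γ * |f vs| * |g v| ^ 2)) ≤
          ENNReal.ofReal C * eL2w 5 f * (eH1w (γ / 2) g) ^ (2 : ℕ) := by
  obtain ⟨K, hK, hK4⟩ := exists_lintegral_pow_four_le_eH1w (γ / 2)
  set k : EuclideanSpace ℝ (Fin 3) → ℝ≥0∞ := fun z =>
    ENNReal.ofReal ((Metric.closedBall 0 1).indicator (fun z => ‖z‖ ^ γ) z) with hk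
  set A : ℝ≥0∞ := (∫⁻ v, ENNReal.ofReal (jb v ^ (-2 : ℝ)) ^ 2) ^ ((1 : ℝ) / 2) with hA
  have hAtop : A ≠ ∞ := ENNReal.rpow_ne_top_of_nonneg (by norm_num) lintegral_jb_lt_top.ne
  have hBtop : ∫⁻ z, k z ≠ ∞ := (lintegral_norm_rpow_closedBall_lt_top hγ.1).ne
  set D : ℝ≥0∞ := 64 * (A + (∫⁻ z, k z) * K) with hD
  have hDtop : D ≠ ∞ := by
    exact ENNReal.mul_ne_top (by norm_num)
      (ENNReal.add_ne_top.2 ⟨hAtop, ENNReal.mul_ne_top hBtop hK⟩)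
  refine ⟨D.toReal + 1, by positivity, fun f g hf hg => ?_⟩
  have hDC : D ≤ ENNReal.ofReal (D.toReal + 1) := by
    rw [← ENNReal.ofReal_toReal hDtop]
    exact ENNReal.ofReal_le_ofReal (by simp)
  have hmg : Measurable g := hg.continuous.measurable
  have hmj := measurable_jb
  have hmk : Measurable k := ENNReal.measurable_ofReal.comp
    (Measurable.indicator (by fun_prop) measurableSet_closedBall)
  set F : EuclideanSpace ℝ (Fin 3) → ℝ≥0∞ := fun v =>
    ENNReal.ofReal (jb v ^ (3 : ℝ) * |f v|) with hFdef
  set a : EuclideanSpace ℝ (Fin 3) → ℝ≥0∞ := fun v =>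
    ENNReal.ofReal (jb v ^ (γ / 2) * |g v|) with hadef
  have hmF : Measurable F := by fun_prop
  have hma : Measurable a := by fun_prop
  have hpt : ∀ v w, ENNReal.ofReal (‖v - w‖ ^ γ * |f w| * |g v| ^ 2) ≤
      64 * (F w * a v ^ 2 + k (v - w) * (F w * a v ^ 2)) := by
    intro v w
    have hv := jb_pos v
    have hw := jb_pos w
    have hκ : 0 ≤ (Metric.closedBall (0 : EuclideanSpace ℝ (Fin 3)) 1).indicator
      (fun z => ‖z‖ ^ γ) (v - w) := Set.indicator_nonneg (fun _ _ => by positivity) _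
    have hsq : (jb v ^ (γ / 2)) ^ 2 = jb v ^ γ := by
      rw [← Real.rpow_natCast, ← Real.rpow_mul hv.le]
      norm_num
    have h64 : (64 : ℝ≥0∞) = ENNReal.ofReal 64 := by norm_num
    simp only [hFdef, hadef, hk]
    rw [← ENNReal.ofReal_pow (by positivity), ← ENNReal.ofReal_mul (by positivity),
      ← ENNReal.ofReal_mul hκ, ← ENNReal.ofReal_add (by positivity) (by positivity), h64,
      ← ENNReal.ofReal_mul (by norm_num)]
    apply ENNReal.ofReal_le_ofReal
    rw [mul_pow, hsq]
    calc _ ≤ 64 * (jb v ^ γ * jb w ^ (3 : ℝ)) *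
      (1 + (Metric.closedBall 0 1).indicator (fun z => ‖z‖ ^ γ) (v - w)) *
        |f w| * |g v| ^ 2 := by
          gcongr
          exact norm_sub_rpow_le hγ v w
      _ = _ := by ring
  have hF1 : ∫⁻ w, F w ≤ A * eL2w 5 f := by
    have e : ∀ w, F w = ENNReal.ofReal (jb w ^ (-2 : ℝ)) *
        ENNReal.ofReal (jb w ^ (5 : ℝ) * |f w|) := by
      intro w
      have hw := jb_pos w
      rw [← ENNReal.ofReal_mul (by positivity), ← mul_assoc, ← Real.rpow_add hw]
      norm_num [hFdef]
    simp only [e]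
    exact lintegral_mul_le_sqrt (Measurable.aemeasurable (by fun_prop))
      (Measurable.aemeasurable (by fun_prop))
  have hF2 : (∫⁻ w, F w ^ 2) ^ ((1 : ℝ) / 2) ≤ eL2w 5 f := by
    have e : ∀ w, F w ≤ ENNReal.ofReal (jb w ^ (5 : ℝ) * |f w|) := fun w =>
      ENNReal.ofReal_le_ofReal (mul_le_mul_of_nonneg_right
        (Real.rpow_le_rpow_of_exponent_le (one_le_jb w) (by norm_num)) (abs_nonneg _))
    unfold eL2w
    gcongr with w
    exact e w
  have ha2 : ∫⁻ v, a v ^ 2 ≤ eH1w (γ / 2) g ^ 2 := by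
    rw [← rpow_half_sq (∫⁻ v, a v ^ 2)]
    gcongr
    exact le_self_add
  have ha4 : (∫⁻ v, (a v ^ 2) ^ 2) ^ ((1 : ℝ) / 2) ≤ K * eH1w (γ / 2) g ^ 2 := by
    rw [← sq_rpow_half (K * _)]
    gcongr
    simpa only [← pow_mul] using hK4 g hg
  calc _ ≤ ∫⁻ v, ∫⁻ w, 64 * (F w * a v ^ 2 + k (v - w) * (F w * a v ^ 2)) :=
        lintegral_mono fun v => lintegral_mono fun w => hpt v w
    _ = 64 * ((∫⁻ w, F w) * (∫⁻ v, a v ^ 2) +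
          ∫⁻ v, ∫⁻ w, k (v - w) * (F w * a v ^ 2)) := by
        have e1 : ∀ v, ∫⁻ w, 64 * (F w * a v ^ 2 + k (v - w) * (F w * a v ^ 2)) =
            64 * ((∫⁻ w, F w) * a v ^ 2 + ∫⁻ w, k (v - w) * (F w * a v ^ 2)) := by
          intro v
          rw [lintegral_const_mul _ (by fun_prop), lintegral_add_left (by fun_prop),
            lintegral_mul_const _ hmF]
        simp only [e1]
        rw [lintegral_const_mul' _ _ (by norm_num), lintegral_add_left (by fun_prop),
          lintegral_const_mul _ (by fun_prop)]
    _ ≤ 64 * ((A * eL2w 5 f) * eH1w (γ / 2) g ^ 2 +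
          (∫⁻ z, k z) * (eL2w 5 f * (K * eH1w (γ / 2) g ^ 2))) := by
        gcongr
        refine (lintegral_convolution_mul_le hmk hmF (hma.pow_const 2)).trans ?_
        gcongr
    _ = D * eL2w 5 f * eH1w (γ / 2) g ^ 2 := by rw [hD]; ring
    _ ≤ _ := by gcongr
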